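/- arXiv:quant-ph/0301023 — 3 statements merged into one kernel-verified Lean document; each statement's English description precedes it below -/
import Mathlib

section
/- For all probability distributions p and q on a finite set Ω, 1 − F(p,q) ≤ ‖p − q‖ ≤ √(1 − F(p,q)²), where F is the fidelity and ‖p − q‖ the variation distance; equivalently, 1 − ‖p − q‖ ≤ F(p,q) ≤ √(1 − ‖p − q‖²). -/
theorem sq_sqrt_sub_sqrt {a b : ℝ} (ha : 0 ≤ a) (hb : 0 ≤ b) :
    (√a - √b) ^ 2 = a + b - 2 * √(a * b) := by
  rw [Real.sqrt_mul ha, sub_sq, Real.sq_sqrt ha, Real.sq_sqrt hb]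
  ring

theorem sq_sqrt_add_sqrt {a b : ℝ} (ha : 0 ≤ a) (hb : 0 ≤ b) :
    (√a + √b) ^ 2 = a + b + 2 * √(a * b) := by
  rw [Real.sqrt_mul ha, add_sq, Real.sq_sqrt ha, Real.sq_sqrt hb]
  ring

theorem abs_sub_eq_abs_sqrt_sub_mul {a b : ℝ} (ha : 0 ≤ a) (hb : 0 ≤ b) :
    |a - b| = |√a - √b| * (√a + √b) := by
  rw [← abs_of_nonneg (add_nonneg (Real.sqrt_nonneg a) (Real.sqrt_nonneg b)), ← abs_mul,
    mul_comm, ← sq_sub_sq, Real.sq_sqrt ha, Real.sq_sqrt hb]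

theorem sq_sqrt_sub_sqrt_le_abs_sub {a b : ℝ} (ha : 0 ≤ a) (hb : 0 ≤ b) :
    (√a - √b) ^ 2 ≤ |a - b| := by
  rw [abs_sub_eq_abs_sqrt_sub_mul ha hb, ← sq_abs, sq]
  gcongr
  rw [abs_le]
  constructor <;> linarith [Real.sqrt_nonneg a, Real.sqrt_nonneg b]

/-- For probability distributions `p, q` on a finite set `Ω`,
`1 − F(p,q) ≤ ‖p − q‖ ≤ √(1 − F(p,q)²)`, where `F(p,q) = Σ √(p x · q x)` is the fidelity
and `‖p − q‖ = (1/2) Σ |p x − q x|` the variation distance; equivalently,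
`1 − ‖p − q‖ ≤ F(p,q) ≤ √(1 − ‖p − q‖²)`. -/
theorem stmt_1 {Ω : Type*} [Fintype Ω] (p q : Ω → ℝ)
    (hp0 : ∀ x, 0 ≤ p x) (hq0 : ∀ x, 0 ≤ q x)
    (hp1 : ∑ x, p x = 1) (hq1 : ∑ x, q x = 1) :
    (1 - ∑ x, Real.sqrt (p x * q x) ≤ (1 / 2) * ∑ x, |p x - q x|) ∧
    ((1 / 2) * ∑ x, |p x - q x| ≤
      Real.sqrt (1 - (∑ x, Real.sqrt (p x * q x)) ^ 2)) ∧
    (1 - (1 / 2) * ∑ x, |p x - q x| ≤ ∑ x, Real.sqrt (p x * q x)) ∧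
    (∑ x, Real.sqrt (p x * q x) ≤
      Real.sqrt (1 - ((1 / 2) * ∑ x, |p x - q x|) ^ 2)) := by
  have hsub : ∑ x, (√(p x) - √(q x)) ^ 2 = 2 - 2 * ∑ x, √(p x * q x) := by
    simp only [sq_sqrt_sub_sqrt (hp0 _) (hq0 _), Finset.sum_sub_distrib, Finset.sum_add_distrib,
      ← Finset.mul_sum, hp1, hq1]
    norm_num
  have hadd : ∑ x, (√(p x) + √(q x)) ^ 2 = 2 + 2 * ∑ x, √(p x * q x) := by
    simp only [sq_sqrt_add_sqrt (hp0 _) (hq0 _), Finset.sum_add_distrib,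
      ← Finset.mul_sum, hp1, hq1]
    norm_num
  have hlower : 2 - 2 * ∑ x, √(p x * q x) ≤ ∑ x, |p x - q x| :=
    hsub ▸ Finset.sum_le_sum fun x _ => sq_sqrt_sub_sqrt_le_abs_sub (hp0 x) (hq0 x)
  have hupper : (∑ x, |p x - q x|) ^ 2 ≤
      (2 - 2 * ∑ x, √(p x * q x)) * (2 + 2 * ∑ x, √(p x * q x)) := by
    have h := Finset.sum_mul_sq_le_sq_mul_sq Finset.univ
      (fun x => |√(p x) - √(q x)|) (fun x => √(p x) + √(q x))
    simpa only [← abs_sub_eq_abs_sqrt_sub_mul (hp0 _) (hq0 _), sq_abs, hsub, hadd] using h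
  refine ⟨by linarith, Real.le_sqrt_of_sq_le ?_, by linarith, Real.le_sqrt_of_sq_le ?_⟩ <;>
    linarith
end

section
/- (Decomposition lemma) Let n ≥ 2, N = 2^n, and let H be a Hermitian N×N complex matrix with at most D nonzero entries in each row. Then there exist Hermitian N×N matrices H₁, …, H_K with K = (D+1)²·n⁶ such that H = Σ_{m=1}^K H_m; every nonzero entry of each H_m equals the corresponding entry of H; and each H_m is 2×2 combinatorially block diagonal: there is a partition of the index set {1,…,N} into parts of size at most 2 such that (H_m)_{ij} = 0 whenever i and j lie in different parts, and (H_m)_{ii} = 0 whenever i lies in a part of size 2. -/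
/-- Greedy colouring: a symmetric relation in which every element is related to fewer than `k`
elements admits a proper colouring with `k` colours. -/
theorem exists_coloring_of_ncard_lt {α : Type*} [Finite α] {r : α → α → Prop}
    (hr : ∀ a b, r a b → r b a) {k : ℕ} (hk : ∀ a, {b | r a b}.ncard < k) (hk0 : 0 < k) :
    ∃ c : α → Fin k, ∀ a b, a ≠ b → r a b → c a ≠ c b := by
  classical
  have := Fintype.ofFinite α
  suffices h : ∀ s : Finset α, ∃ c : α → Fin k,
      ∀ a ∈ s, ∀ b ∈ s, a ≠ b → r a b → c a ≠ c b by
    obtain ⟨c, hc⟩ := h Finset.univ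
    exact ⟨c, fun a b => hc a (Finset.mem_univ a) b (Finset.mem_univ b)⟩
  intro s
  induction s using Finset.induction_on with
  | empty => exact ⟨fun _ => ⟨0, hk0⟩, by simp⟩
  | insert x s hx ih =>
    obtain ⟨c, hc⟩ := ih
    obtain ⟨m, hm⟩ : ∃ m : Fin k, m ∉ c '' {b | r x b} := by
      by_contra! h
      have h1 : (c '' {b | r x b}).ncard ≤ {b | r x b}.ncard := Set.ncard_image_le
      rw [Set.eq_univ_of_forall h, Set.ncard_univ, Nat.card_fin] at h1
      exact (hk x).not_ge h1
    have hm' : ∀ b, r x b → c b ≠ m := fun b hb h => hm ⟨b, hb, h⟩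
    refine ⟨Function.update c x m, fun a ha b hb hab hrab => ?_⟩
    rcases eq_or_ne a x with rfl | hax
    · simpa [Function.update_of_ne hab.symm] using (hm' b hrab).symm
    · rcases eq_or_ne b x with rfl | hbx
      · simpa [Function.update_of_ne hax] using hm' a (hr _ _ hrab)
      · rw [Function.update_of_ne hax, Function.update_of_ne hbx]
        exact hc a (Finset.mem_of_mem_insert_of_ne ha hax) b
          (Finset.mem_of_mem_insert_of_ne hb hbx) hab hrab

/-- If the nonzero pattern `r` of a matrix has degree at most `D`, then the edges of `r`, loops
included, can be coloured with `k > 2 * D` colours so that each vertex has at most one edge of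
each colour. -/
theorem exists_edge_coloring {ι : Type*} [Finite ι] {r : ι → ι → Prop}
    {D k : ℕ} (hD : ∀ i, {j | r i j}.ncard ≤ D) (hk : 2 * D < k) :
    ∃ c : Sym2 ι → Fin k, ∀ i j l, r i j → r i l → c s(i, j) = c s(i, l) → j = l := by
  have hcard : ∀ e : Sym2 ι,
      {f | ∃ i j l, r i j ∧ r i l ∧ e = s(i, j) ∧ f = s(i, l)}.ncard < k := by
    rintro ⟨x, y⟩
    refine lt_of_le_of_lt ?_ hk
    calc _ ≤ ((fun l => s(x, l)) '' {l | r x l} ∪ (fun l => s(y, l)) '' {l | r y l}).ncard := by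
          refine Set.ncard_le_ncard ?_
          rintro f ⟨i, j, l, -, hl, he, rfl⟩
          rcases Sym2.eq_iff.1 he with ⟨rfl, rfl⟩ | ⟨rfl, rfl⟩
          · exact Or.inl ⟨l, hl, rfl⟩
          · exact Or.inr ⟨l, hl, rfl⟩
      _ ≤ _ := Set.ncard_union_le _ _
      _ ≤ D + D :=
          add_le_add (le_trans Set.ncard_image_le (hD x)) (le_trans Set.ncard_image_le (hD y))
      _ = 2 * D := (two_mul D).symm
  obtain ⟨c, hc⟩ := exists_coloring_of_ncard_lt
    (fun e f ⟨i, j, l, hj, hl, he, hf⟩ => ⟨i, l, j, hl, hj, hf, he⟩) hcard (by lia)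
  refine ⟨c, fun i j l hj hl h => ?_⟩
  by_contra hne
  exact hc _ _ (fun h => hne (Sym2.congr_right.1 h)) ⟨i, j, l, hj, hl, rfl, rfl⟩ h

/-- A symmetric relation relating each element to at most one element splits a finite type into
parts of size at most two, with no loops inside the parts of size two. -/
theorem exists_finpartition_of_matching {ι : Type*} [Fintype ι] [DecidableEq ι]
    {r : ι → ι → Prop} (hr : ∀ i j, r i j → r j i) (hu : ∀ i j l, r i j → r i l → j = l) :
    ∃ P : Finpartition (Finset.univ : Finset ι),
      (∀ s ∈ P.parts, s.card ≤ 2) ∧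
      (∀ i j, ∀ s ∈ P.parts, i ∈ s → j ∉ s → ¬ r i j) ∧
      (∀ i, ∀ s ∈ P.parts, i ∈ s → s.card = 2 → ¬ r i i) := by
  classical
  let S : Setoid ι :=
    { r := fun i j => i = j ∨ r i j
      iseqv :=
        { refl := fun i => Or.inl rfl
          symm := fun h => h.imp Eq.symm (hr _ _)
          trans := by
            rintro i j l (rfl | hij) (rfl | hjl)
            · exact Or.inl rfl
            · exact Or.inr hjl
            · exact Or.inr hij
            · exact Or.inl (hu j i l (hr _ _ hij) hjl) } }
  have key : ∀ s ∈ (Finpartition.ofSetoid S).parts, ∀ i ∈ s, ∀ j, j ∈ s ↔ i = j ∨ r i j := by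
    intro s hs i hi j
    rw [← Finpartition.part_eq_of_mem _ hs hi]
    exact Finpartition.mem_part_ofSetoid_iff_rel
  refine ⟨Finpartition.ofSetoid S, fun s hs => ?_, fun i j s hs hi hj h => ?_,
    fun i s hs hi hcard h => ?_⟩
  · by_contra! hcard
    obtain ⟨a, b, c, ha, hb, hc, hab, hac, hbc⟩ := Finset.two_lt_card_iff.1 hcard
    exact hbc (hu a b c (((key s hs a ha b).1 hb).resolve_left hab)
      (((key s hs a ha c).1 hc).resolve_left hac))
  · exact hj ((key s hs i hi j).2 (Or.inr h))
  · obtain ⟨j, hj, hne⟩ := Finset.exists_mem_ne (by lia : 1 < s.card) i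
    exact hne (hu i j i (((key s hs i hi j).1 hj).resolve_left hne.symm) h)


/-- Decomposition lemma: a Hermitian `2^n × 2^n` matrix with at most `D`
nonzero entries per row decomposes as a sum of `(D+1)²·n⁶` Hermitian matrices, each of
whose nonzero entries equals the corresponding entry of `H`, and each of which is
`2 × 2` combinatorially block diagonal (with zero diagonal entries inside parts of
size 2). -/
theorem stmt_5 (n D : ℕ) (hn : 2 ≤ n) (H : Matrix (Fin (2 ^ n)) (Fin (2 ^ n)) ℂ)
    (hHerm : H.IsHermitian)
    (hsparse : ∀ i, {j | H i j ≠ 0}.ncard ≤ D) :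
    ∃ Hm : Fin ((D + 1) ^ 2 * n ^ 6) → Matrix (Fin (2 ^ n)) (Fin (2 ^ n)) ℂ,
      (∑ m, Hm m) = H ∧
      (∀ m, (Hm m).IsHermitian) ∧
      (∀ m i j, Hm m i j = 0 ∨ Hm m i j = H i j) ∧
      (∀ m, ∃ P : Finpartition (Finset.univ : Finset (Fin (2 ^ n))),
        (∀ s ∈ P.parts, s.card ≤ 2) ∧
        (∀ (i j : Fin (2 ^ n)), ∀ s ∈ P.parts, i ∈ s → j ∉ s → Hm m i j = 0) ∧
        (∀ i : Fin (2 ^ n), ∀ s ∈ P.parts, i ∈ s → s.card = 2 → Hm m i i = 0)) := by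
  classical
  have hsymm : ∀ i j, H i j ≠ 0 → H j i ≠ 0 := fun i j h => by
    rw [← hHerm.apply j i]
    exact star_ne_zero.2 h
  have hk : 2 * D < (D + 1) ^ 2 * n ^ 6 :=
    calc 2 * D < (D + 1) ^ 2 := by nlinarith
      _ ≤ (D + 1) ^ 2 * n ^ 6 := Nat.le_mul_of_pos_right _ (by positivity)
  obtain ⟨c, hc⟩ := exists_edge_coloring hsparse hk
  refine ⟨fun m => Matrix.of fun i j => if c s(i, j) = m then H i j else 0, ?_, fun m => ?_,
    fun m i j => ?_, fun m => ?_⟩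
  · ext i j
    simp [Matrix.sum_apply]
  · ext i j
    simp only [Matrix.conjTranspose_apply, Matrix.of_apply, Sym2.eq_swap (a := j)]
    split_ifs
    · exact hHerm.apply i j
    · exact star_zero _
  · by_cases h : c s(i, j) = m <;> simp [h]
  · obtain ⟨P, h2, hoff, hdiag⟩ := exists_finpartition_of_matching
      (r := fun i j => c s(i, j) = m ∧ H i j ≠ 0)
      (fun i j h => ⟨Sym2.eq_swap (a := i) ▸ h.1, hsymm i j h.2⟩)
      (fun i j l hj hl => hc i j l hj.2 hl.2 (hj.1.trans hl.1.symm))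
    exact ⟨P, h2, fun i j s hs hi hj => by simpa using hoff i j s hs hi hj,
      fun i s hs hi hcard => by simpa using hdiag i s hs hi hcard⟩
end

section
/- For every integer n ≥ 2 and all distinct natural numbers i, j with i < 2^n and j < 2^n, there exists an integer k with 2 ≤ k ≤ n² such that i mod k ≠ j mod k. -/
theorem two_pow_le_lcmUpto_sq {n : ℕ} (hn : 2 ≤ n) : 2 ^ n ≤ Nat.lcmUpto (n ^ 2) := by
  obtain rfl | hn3 := hn.eq_or_lt
  · decide
  have hsucc : n ^ 2 + 1 ≤ 2 ^ (2 * n) := calc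
    n ^ 2 + 1 ≤ (n + 1) ^ 2 := by nlinarith
    _ ≤ (2 ^ n) ^ 2 := Nat.pow_le_pow_left Nat.lt_two_pow_self 2
    _ = 2 ^ (2 * n) := by rw [← pow_mul, mul_comm]
  refine Nat.le_of_mul_le_mul_left ?_ (n ^ 2).succ_pos
  calc
    (n ^ 2 + 1) * 2 ^ n ≤ 2 ^ (2 * n) * 2 ^ n := Nat.mul_le_mul_right _ hsucc
    _ = 2 ^ (2 * n + n) := (pow_add ..).symm
    _ ≤ 2 ^ n ^ 2 := Nat.pow_le_pow_right two_pos (by nlinarith)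
    _ ≤ (n ^ 2 + 1) * Nat.lcmUpto (n ^ 2) := Chebyshev.two_pow_le_mul_lcmUpto _

theorem modEq_lcmUpto {m i j : ℕ} (h : ∀ k, 2 ≤ k → k ≤ m → i ≡ j [MOD k]) :
    i ≡ j [MOD Nat.lcmUpto m] := by
  rw [Nat.modEq_iff_dvd, Int.natCast_dvd]
  refine Finset.lcm_dvd fun k hk ↦ ?_
  obtain ⟨hk1, hkm⟩ := Finset.mem_Icc.mp hk
  obtain rfl | hk2 := hk1.eq_or_lt
  · exact one_dvd _
  · exact Int.natCast_dvd.mp (h k hk2 hkm).dvd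

/-- for `n ≥ 2` and distinct `i, j < 2^n` there is `k` with `2 ≤ k ≤ n²`
and `i mod k ≠ j mod k`. -/
theorem stmt_6 (n : ℕ) (hn : 2 ≤ n) (i j : ℕ) (hij : i ≠ j)
    (hi : i < 2 ^ n) (hj : j < 2 ^ n) :
    ∃ k : ℕ, 2 ≤ k ∧ k ≤ n ^ 2 ∧ i % k ≠ j % k := by
  by_contra! h
  have hL := two_pow_le_lcmUpto_sq hn
  exact hij ((modEq_lcmUpto h).eq_of_lt_of_lt (hi.trans_le hL) (hj.trans_le hL))
end
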